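/- Let d ≥ 3 and let F ≤ Sym({1,…,d}) be transitive and generated by its point stabilizers, and set 𝔾 = U(F)⁺. Then 𝔾 acts transitively on the set of ends ∂𝒯 if and only if every hyperbolic element of 𝔾 is a power of a hyperbolic element of 𝔾 of translation length two. -/

import Mathlib

open Filter Topology
open scoped InnerProductSpace

namespace TreeHM

variable {V : Type}

/-! ### The automorphism group of a graph, with the topology of pointwise convergence -/

noncomputable instance autTopologicalSpace (T : SimpleGraph V) : TopologicalSpace (T ≃g T) :=
  letI : TopologicalSpace V := ⊥
  TopologicalSpace.induced (fun (g : T ≃g T) (x : V) => g x) inferInstance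

/-- A graph automorphism preserves the combinatorial distance. -/
theorem iso_dist_le (T : SimpleGraph V) (g : T ≃g T) (u v : V) :
    T.dist (g u) (g v) ≤ T.dist u v := by
  by_cases h : T.Reachable u v
  · obtain ⟨p, hp⟩ := h.exists_walk_length_eq_dist
    calc T.dist (g u) (g v) ≤ (p.map g.toHom).length := SimpleGraph.dist_le _
      _ = p.length := SimpleGraph.Walk.length_map _ _
      _ = T.dist u v := hp
  · rw [SimpleGraph.dist_eq_zero_of_not_reachable h,
      SimpleGraph.dist_eq_zero_of_not_reachable]
    intro hr
    have := hr.map g.symm.toHom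
    exact h (by simpa using this)

theorem iso_dist_eq (T : SimpleGraph V) (g : T ≃g T) (u v : V) :
    T.dist (g u) (g v) = T.dist u v := by
  refine le_antisymm (iso_dist_le T g u v) ?_
  have := iso_dist_le T g⁻¹ (g u) (g v)
  simpa using this

/-- The tree `T` is locally finite. -/
def LocFin (T : SimpleGraph V) : Prop := ∀ x : V, (T.neighborSet x).Finite

/-- The graph `T` is `d`-regular: every vertex has exactly `d` neighbours. -/
def Regular (T : SimpleGraph V) (d : ℕ) : Prop := ∀ x : V, (T.neighborSet x).ncard = d

/-! ### Geodesic rays and ends -/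

/-- A geodesic ray in a graph; for a tree, the ends `∂T` are the equivalence classes of
geodesic rays under the relation `RayEquiv` of sharing a common subray.  Throughout, an end
`ξ ∈ ∂T` is represented by a geodesic ray, and equality of ends is `RayEquiv`. -/
structure GeodRay (T : SimpleGraph V) : Type where
  seq : ℕ → V
  adj : ∀ n, T.Adj (seq n) (seq (n + 1))
  geodesic : ∀ m n, T.dist (seq m) (seq n) = Nat.dist m n

/-- A bi-infinite geodesic line in a graph. -/
structure GeodLine (T : SimpleGraph V) : Type where
  seq : ℤ → V
  adj : ∀ n, T.Adj (seq n) (seq (n + 1))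
  geodesic : ∀ m n, T.dist (seq m) (seq n) = (m - n).natAbs

/-- Two geodesic rays are equivalent (define the same end) iff they share a common subray. -/
def RayEquiv (T : SimpleGraph V) (r s : GeodRay T) : Prop :=
  ∃ k l : ℕ, ∀ n : ℕ, r.seq (k + n) = s.seq (l + n)

/-- The image of a geodesic ray under an automorphism. -/
def mapRay (T : SimpleGraph V) (g : T ≃g T) (r : GeodRay T) : GeodRay T where
  seq := fun n => g (r.seq n)
  adj := fun n => g.map_adj_iff.mpr (r.adj n)
  geodesic := fun m n => by rw [iso_dist_eq]; exact r.geodesic m n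

/-- `g` fixes the end represented by the ray `r`. -/
def FixesEnd (T : SimpleGraph V) (g : T ≃g T) (r : GeodRay T) : Prop :=
  RayEquiv T (mapRay T g r) r

/-- A sequence of vertices converges to the end represented by the geodesic ray `r`:
for every `m`, the vertex `r.seq m` eventually lies on the geodesic from `r.seq 0` to `y n`,
i.e. the common initial segment of `[r.seq 0, y n]` and the ray tends to infinity. -/
def TendstoEnd (T : SimpleGraph V) (y : ℕ → V) (r : GeodRay T) : Prop :=
  ∀ m : ℕ, ∀ᶠ n in atTop, T.dist (r.seq 0) (y n) = m + T.dist (r.seq m) (y n)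

/-! ### Translation length and hyperbolic automorphisms -/

/-- The translation length `|g| = min_x dist(x, g x)` of an automorphism. -/
noncomputable def transLen (T : SimpleGraph V) (g : T ≃g T) : ℕ :=
  sInf (Set.range fun x : V => T.dist x (g x))

/-- `g` is hyperbolic iff its translation length is positive. -/
def IsHyperbolic (T : SimpleGraph V) (g : T ≃g T) : Prop := 0 < transLen T g

/-- The set `Min(g)` of vertices realizing the translation length; for a hyperbolic
automorphism of a tree this is its translation axis. -/
def MinSet (T : SimpleGraph V) (g : T ≃g T) : Set V :=
  {x : V | T.dist x (g x) = transLen T g}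

/-- The ray `r` (based at the axis) represents the attracting end of `a`:
the orbit `a^n x` converges to this end. -/
def IsAttractingEnd (T : SimpleGraph V) (a : T ≃g T) (r : GeodRay T) : Prop :=
  TendstoEnd T (fun n : ℕ => (a ^ n) (r.seq 0)) r

/-! ### Half-trees and Tits' independence property -/

/-- The half-tree determined by an oriented edge `(a, b)` of a tree:  all vertices `y`
lying on the side of `a`, i.e. whose geodesic to `b` passes through `a`. -/
def EdgeSide (T : SimpleGraph V) (a b : V) : Set V :=
  {y : V | T.dist b y = T.dist a y + 1}

/-- The half-tree emanating from the base vertex `r.seq 0` of a ray `r` and containing the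
end of `r` in its boundary. -/
def RaySide (T : SimpleGraph V) (r : GeodRay T) : Set V :=
  {y : V | y = r.seq 0 ∨ T.dist (r.seq 0) y = 1 + T.dist (r.seq 1) y}

/-- Tits' independence property for a subgroup `G ≤ Aut(T)`:  for every edge `e = (a, b)`,
the pointwise stabilizer `G_e` decomposes as `G_{T₁} · G_{T₂}`, where `T₁, T₂` are the two
half-trees emanating from `e` and `G_{Tᵢ}` is the pointwise stabilizer of `Tᵢ`. -/
def TitsIndep (T : SimpleGraph V) (G : Subgroup (T ≃g T)) : Prop :=
  ∀ a b : V, T.Adj a b → ∀ g ∈ G, g a = a → g b = b →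
    ∃ g₁ ∈ G, ∃ g₂ ∈ G, g = g₁ * g₂ ∧
      (∀ y ∈ EdgeSide T a b, g₁ y = y) ∧ (∀ y ∈ EdgeSide T b a, g₂ y = y)

/-! ### Stabilizers and contraction groups -/

/-- The subgroup `G_ξ⁰ = {g ∈ G : g ξ = ξ and g fixes some vertex}`, as a subset of `G`. -/
def EndStab0 (T : SimpleGraph V) (G : Subgroup (T ≃g T)) (ξ : GeodRay T) : Set G :=
  {g : G | FixesEnd T (g : T ≃g T) ξ ∧ ∃ x : V, (g : T ≃g T) x = x}

/-- The contraction group `U⁺_α` of a sequence `α` in `G`. -/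
def ContrSeq {G : Type} [Group G] [TopologicalSpace G] (α : ℕ → G) : Set G :=
  {g : G | Tendsto (fun n : ℕ => (α n)⁻¹ * g * α n) atTop (𝓝 1)}

/-- The contraction group `U⁺_a = {g : a⁻ⁿ g aⁿ → 1}` of an element `a` of `G`. -/
def Upos {G : Type} [Group G] [TopologicalSpace G] (a : G) : Set G :=
  ContrSeq (fun n : ℕ => a ^ n)

/-- The contraction group `U⁻_a = {g : aⁿ g a⁻ⁿ → 1}` of an element `a` of `G`. -/
def Uneg {G : Type} [Group G] [TopologicalSpace G] (a : G) : Set G :=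
  ContrSeq (fun n : ℕ => (a ^ n)⁻¹)

/-! ### Unitary representations and the Howe–Moore property -/

/-- A (strongly continuous) unitary representation of a topological group `G` on a complex
inner product space `H`. -/
structure UnitaryRep (G : Type) [Group G] [TopologicalSpace G]
    (H : Type) [NormedAddCommGroup H] [InnerProductSpace ℂ H] where
  ρ : G →* (H ≃ₗᵢ[ℂ] H)
  strong_continuity : ∀ v : H, Continuous fun g : G => ρ g v

/-- The representation `π` has no nonzero `G`-invariant vector. -/
def NoInvariantVectors {G : Type} [Group G] [TopologicalSpace G]
    {H : Type} [NormedAddCommGroup H] [InnerProductSpace ℂ H]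
    (π : UnitaryRep G H) : Prop :=
  ∀ v : H, (∀ g : G, π.ρ g v = v) → v = 0

/-- The Howe–Moore property: every unitary representation without nonzero invariant vectors
has all its matrix coefficients vanishing at infinity. -/
def HasHoweMoore (G : Type) [Group G] [TopologicalSpace G] : Prop :=
  ∀ (H : Type) [NormedAddCommGroup H] [InnerProductSpace ℂ H] [CompleteSpace H]
    (π : UnitaryRep G H), NoInvariantVectors π →
      ∀ v w : H, Tendsto (fun g : G => ⟪π.ρ g v, w⟫_ℂ) (cocompact G) (𝓝 0)

/-! ### Legal colorings and the universal groups of Burger–Mozes -/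

/-- A legal coloring of a `d`-regular tree: a coloring of the (unoriented) edges by
`{1, …, d}` whose restriction to the star of each vertex is a bijection onto `{1, …, d}`.
The color of the edge `{x, y}` is recorded as `color x y` with `color x y = color y x`. -/
structure LegalColoring (T : SimpleGraph V) (d : ℕ) where
  color : V → V → Fin d
  symm : ∀ x y : V, T.Adj x y → color x y = color y x
  injOn : ∀ x : V, Set.InjOn (color x) (T.neighborSet x)
  surjOn : ∀ x : V, Set.SurjOn (color x) (T.neighborSet x) Set.univ

/-- Membership in the universal group `U(F)`: at every vertex `x` the local action of `g`
on colors is given by an element of `F`. -/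
def InUF {d : ℕ} (T : SimpleGraph V) (F : Subgroup (Equiv.Perm (Fin d)))
    (ι : LegalColoring T d) (g : T ≃g T) : Prop :=
  ∀ x : V, ∃ σ ∈ F, ∀ y : V, T.Adj x y → σ (ι.color x y) = ι.color (g x) (g y)

/-- The universal group `U(F)⁺`: the subgroup of `Aut(T)` generated by the elements of
`U(F)` fixing (pointwise) an edge of `T`. -/
def UFplus {d : ℕ} (T : SimpleGraph V) (F : Subgroup (Equiv.Perm (Fin d)))
    (ι : LegalColoring T d) : Subgroup (T ≃g T) :=
  Subgroup.closure
    {g : T ≃g T | InUF T F ι g ∧ ∃ x y : V, T.Adj x y ∧ g x = x ∧ g y = y}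

/-! ### Permutation group conditions -/

/-- `F` acts transitively on `{1, …, d}`. -/
def PermTransitive {d : ℕ} (F : Subgroup (Equiv.Perm (Fin d))) : Prop :=
  ∀ i j : Fin d, ∃ σ ∈ F, σ i = j

/-- `F` acts 2-transitively on `{1, …, d}`. -/
def PermTwoTransitive {d : ℕ} (F : Subgroup (Equiv.Perm (Fin d))) : Prop :=
  ∀ a b c e : Fin d, a ≠ b → c ≠ e → ∃ σ ∈ F, σ a = c ∧ σ b = e

/-- `F` acts primitively on `{1, …, d}`: it is transitive and every block of the action
is trivial (a subsingleton or the whole set). -/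
def PermPrimitive {d : ℕ} (F : Subgroup (Equiv.Perm (Fin d))) : Prop :=
  PermTransitive F ∧
    ∀ B : Set (Fin d),
      (∀ σ ∈ F, (σ : Equiv.Perm (Fin d)) '' B = B ∨
        Disjoint ((σ : Equiv.Perm (Fin d)) '' B) B) →
      B.Subsingleton ∨ B = Set.univ

/-- `F` is a cyclic group of prime order. -/
def CyclicOfPrimeOrder {d : ℕ} (F : Subgroup (Equiv.Perm (Fin d))) : Prop :=
  IsCyclic F ∧ (Nat.card F).Prime

/-- `F` is generated by its point stabilizers `F_i = {σ ∈ F : σ i = i}`. -/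
def GenByPointStabilizers {d : ℕ} (F : Subgroup (Equiv.Perm (Fin d))) : Prop :=
  F = Subgroup.closure {σ : Equiv.Perm (Fin d) | σ ∈ F ∧ ∃ i : Fin d, σ i = i}



/-! ### Basic facts on trees -/

theorem parent_exists {T : SimpleGraph V} (hT : T.IsTree) (u v : V) (h : u ≠ v) :
    ∃ w, T.Adj w v ∧ T.dist u w + 1 = T.dist u v := by
  obtain ⟨p, hp⟩ := hT.connected.exists_walk_length_eq_dist v u
  cases p with
  | nil => exact absurd rfl h
  | @cons _ w _ hvw q =>
    refine ⟨w, hvw.symm, ?_⟩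
    have h1 : T.dist w u ≤ q.length := SimpleGraph.dist_le q
    have h2 := hT.dist_eq_dist_add_one_of_adj u hvw
    simp only [SimpleGraph.Walk.length_cons] at hp
    rw [SimpleGraph.dist_comm] at h1 hp
    omega

theorem parent_unique {T : SimpleGraph V} (hT : T.IsTree) {u v w w' : V} (h : T.Adj w v)
    (h' : T.Adj w' v) (hd : T.dist u w + 1 = T.dist u v) (hd' : T.dist u w' + 1 = T.dist u v) :
    w = w' := by
  obtain ⟨p, hp⟩ := hT.connected.exists_walk_length_eq_dist u w
  obtain ⟨q, hq⟩ := hT.connected.exists_walk_length_eq_dist u w'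
  have hp' : (p.concat h).IsPath := by
    apply SimpleGraph.Walk.isPath_of_length_eq_dist
    rw [SimpleGraph.Walk.length_concat]; omega
  have hq' : (q.concat h').IsPath := by
    apply SimpleGraph.Walk.isPath_of_length_eq_dist
    rw [SimpleGraph.Walk.length_concat]; omega
  have := (hT.existsUnique_path u v).unique hp' hq'
  have h3 := congrArg SimpleGraph.Walk.penultimate this
  simpa using h3

/-- An integer valued 1-Lipschitz function. -/
theorem lip_le {T : SimpleGraph V} (hT : T.IsTree) (f : V → ℤ)
    (hf : ∀ v w, T.Adj v w → f v ≤ f w + 1) (v w : V) : f v ≤ f w + T.dist v w := by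
  obtain ⟨p, hp⟩ := hT.connected.exists_walk_length_eq_dist v w
  rw [← hp]
  clear hp
  induction p with
  | nil => simp
  | cons h q ih =>
    have := hf _ _ h
    simp only [SimpleGraph.Walk.length_cons]
    push_cast
    omega

theorem conn_ind {T : SimpleGraph V} (hT : T.IsTree) (P : V → Prop)
    (x : V) (hx : P x) (hP : ∀ v w, T.Adj v w → P v → P w) (v : V) : P v := by
  obtain ⟨p⟩ := hT.connected x v
  induction p with
  | nil => exact hx
  | cons h q ih => exact ih (hP _ _ h hx)

theorem dist_parity {T : SimpleGraph V} (hT : T.IsTree) (x y z : V) :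
    Even (T.dist x y + T.dist y z + T.dist x z) := by
  refine conn_ind hT (fun z => Even (T.dist x y + T.dist y z + T.dist x z)) y ?_ ?_ z
  · simp
  · intro v w hvw h
    have h1 := hT.dist_eq_dist_add_one_of_adj x hvw
    have h2 := hT.dist_eq_dist_add_one_of_adj y hvw
    rw [Nat.even_iff] at h ⊢
    omega

theorem nonbacktrack {T : SimpleGraph V} (hT : T.IsTree) (x : ℕ → V)
    (hadj : ∀ n, T.Adj (x n) (x (n + 1))) (hne : ∀ n, x n ≠ x (n + 2)) (n : ℕ) :
    T.dist (x 0) (x n) = n ∧ T.dist (x 0) (x (n + 1)) = n + 1 := by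
  induction n with
  | zero =>
    refine ⟨by simp, ?_⟩
    simpa using hadj 0
  | succ n ih =>
    refine ⟨ih.2, ?_⟩
    rcases hT.dist_eq_dist_add_one_of_adj (x 0) (hadj (n + 1)) with h | h
    · exfalso
      apply hne n
      exact parent_unique hT (u := x 0) (hadj n) (hadj (n + 1)).symm (by omega)
        (by have h' : T.dist (x 0) (x (n + 1)) = T.dist (x 0) (x (n + 2)) + 1 := h
            omega)
    · omega

/-- Build a geodesic line from a locally injective one. -/
theorem line_geod {T : SimpleGraph V} (hT : T.IsTree) (x : ℤ → V)
    (hadj : ∀ n, T.Adj (x n) (x (n + 1))) (hne : ∀ n, x n ≠ x (n + 2)) (m n : ℤ) :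
    T.dist (x m) (x n) = (m - n).natAbs := by
  have key : ∀ (m : ℤ) (k : ℕ), T.dist (x m) (x (m + k)) = k := by
    intro m k
    have := (nonbacktrack hT (fun k => x (m + k))
      (fun n => by simpa [add_assoc] using hadj (m + n))
      (fun n => by simpa [add_assoc] using hne (m + n)) k).1
    simpa using this
  rcases le_total m n with h | h
  · obtain ⟨k, rfl⟩ := Int.le.dest h
    rw [key]; omega
  · obtain ⟨k, rfl⟩ := Int.le.dest h
    rw [SimpleGraph.dist_comm, key]; omega

def mkLine {T : SimpleGraph V} (hT : T.IsTree) (x : ℤ → V)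
    (hadj : ∀ n, T.Adj (x n) (x (n + 1))) (hne : ∀ n, x n ≠ x (n + 2)) : GeodLine T :=
  ⟨x, hadj, line_geod hT x hadj hne⟩

theorem GeodLine.inj {T : SimpleGraph V} (L : GeodLine T) {i j : ℤ}
    (h : L.seq i = L.seq j) : i = j := by
  have := L.geodesic i j
  rw [h, SimpleGraph.dist_self] at this
  omega

theorem GeodLine.adj_iff {T : SimpleGraph V} (L : GeodLine T) {i j : ℤ}
    (h : T.Adj (L.seq i) (L.seq j)) : j = i + 1 ∨ i = j + 1 := by
  have := L.geodesic i j
  rw [SimpleGraph.dist_eq_one_iff_adj.mpr h] at this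
  omega

/-! ### Colors -/

noncomputable def step {d : ℕ} {T : SimpleGraph V} (ι : LegalColoring T d) (x : V) (c : Fin d) : V :=
  (ι.surjOn x (Set.mem_univ c)).choose

theorem step_adj {d : ℕ} {T : SimpleGraph V} (ι : LegalColoring T d) (x : V) (c : Fin d) :
    T.Adj x (step ι x c) := (ι.surjOn x (Set.mem_univ c)).choose_spec.1

theorem step_color {d : ℕ} {T : SimpleGraph V} (ι : LegalColoring T d) (x : V) (c : Fin d) :
    ι.color x (step ι x c) = c := (ι.surjOn x (Set.mem_univ c)).choose_spec.2

theorem color_inj {d : ℕ} {T : SimpleGraph V} (ι : LegalColoring T d) {x y z : V}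
    (h : T.Adj x y) (h' : T.Adj x z) (hc : ι.color x y = ι.color x z) : y = z :=
  ι.injOn x h h' hc

theorem exists_line {d : ℕ} {T : SimpleGraph V} (hT : T.IsTree) (ι : LegalColoring T d) (x : V)
    (c : ℤ → Fin d) (hc : ∀ i, c i ≠ c (i + 1)) :
    ∃ L : GeodLine T, L.seq 0 = x ∧ ∀ i, ι.color (L.seq i) (L.seq (i + 1)) = c i := by
  let f : ℕ → V := fun n => Nat.rec x (fun n y => step ι y (c n)) n
  let b : ℕ → V := fun n => Nat.rec x (fun n y => step ι y (c (-((n : ℤ) + 1)))) n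
  have hf : ∀ n, f (n + 1) = step ι (f n) (c n) := fun n => rfl
  have hb : ∀ n, b (n + 1) = step ι (b n) (c (-((n : ℤ) + 1))) := fun n => rfl
  let L : ℤ → V := fun i => if 0 ≤ i then f i.toNat else b (-i).toNat
  have key : ∀ i, T.Adj (L i) (L (i + 1)) ∧ ι.color (L i) (L (i + 1)) = c i := by
    intro i
    by_cases hi : 0 ≤ i
    · obtain ⟨n, rfl⟩ := Int.eq_ofNat_of_zero_le hi
      have h1 : L (n : ℤ) = f n := by simp [L]
      have h2 : L ((n : ℤ) + 1) = f (n + 1) := by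
        have : (0 : ℤ) ≤ n + 1 := by omega
        simp only [L, if_pos this]; congr 1
      rw [h1, h2, hf]
      exact ⟨step_adj _ _ _, step_color _ _ _⟩
    · obtain ⟨n, rfl⟩ : ∃ n : ℕ, i = -((n : ℤ) + 1) := ⟨(-i - 1).toNat, by omega⟩
      have h1 : L (-((n : ℤ) + 1)) = b (n + 1) := by
        simp only [L, if_neg hi]; congr 1
      have h2 : L (-((n : ℤ) + 1) + 1) = b n := by
        by_cases hn : n = 0
        · subst hn; simp [L, f, b]
        · have : ¬ (0 : ℤ) ≤ -((n : ℤ) + 1) + 1 := by omega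
          simp only [L, if_neg this]; congr 1; omega
      rw [h1, h2, hb]
      refine ⟨(step_adj _ _ _).symm, ?_⟩
      rw [ι.symm _ _ (step_adj _ _ _).symm, step_color]
  refine ⟨mkLine hT L (fun i => (key i).1) ?_, by simp [mkLine, L, f], fun i => (key i).2⟩
  intro i h
  have h1 := (key i)
  have h2 := (key (i + 1))
  rw [add_assoc, one_add_one_eq_two, ← h] at h2
  apply hc i
  rw [← h1.2, ← h2.2, ι.symm _ _ h1.1]

theorem line_color_ne {d : ℕ} {T : SimpleGraph V} (ι : LegalColoring T d)
    (L : GeodLine T) (i : ℤ) :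
    ι.color (L.seq i) (L.seq (i + 1)) ≠ ι.color (L.seq (i + 1)) (L.seq (i + 1 + 1)) := by
  intro h
  rw [ι.symm _ _ (L.adj i)] at h
  have := L.inj (color_inj ι (L.adj i).symm (L.adj (i + 1)) h)
  omega

theorem line_track {d : ℕ} {T : SimpleGraph V} (ι : LegalColoring T d) (L L' : GeodLine T)
    (h : T ≃g T) (h0 : h (L.seq 0) = L'.seq 0)
    (hc : ∀ i, ι.color (h (L.seq i)) (h (L.seq (i + 1))) = ι.color (L'.seq i) (L'.seq (i + 1)))
    (i : ℤ) : h (L.seq i) = L'.seq i := by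
  induction i using Int.induction_on with
  | zero => exact h0
  | succ i ih =>
    have h1 := hc i
    have h2 : T.Adj (h (L.seq i)) (h (L.seq (i + 1))) := h.map_adj_iff.mpr (L.adj i)
    rw [ih] at h1 h2
    exact color_inj ι h2 (L'.adj i) h1
  | pred i ih =>
    have h1 := hc (-i - 1)
    have h2 : T.Adj (h (L.seq (-i - 1))) (h (L.seq (-i - 1 + 1))) :=
      h.map_adj_iff.mpr (L.adj (-i - 1))
    have h3 := L'.adj (-i - 1)
    rw [ι.symm _ _ h2, ι.symm _ _ h3] at h1
    rw [sub_add_cancel] at h1 h2 h3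
    rw [ih] at h1 h2
    exact color_inj ι h2.symm h3.symm h1


/-! ### Automorphisms with prescribed local action -/

open Classical in
noncomputable def devMap {d : ℕ} {T : SimpleGraph V} (hT : T.IsTree) (ι : LegalColoring T d)
    (σ : V → Equiv.Perm (Fin d)) (x0 y0 : V) (v : V) : V :=
  if h : x0 = v then y0
  else step ι (devMap hT ι σ x0 y0 (parent_exists hT x0 v h).choose)
    (σ (parent_exists hT x0 v h).choose (ι.color (parent_exists hT x0 v h).choose v))
termination_by T.dist x0 v
decreasing_by
  have := (parent_exists hT x0 v h).choose_spec.2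
  omega

theorem devMap_base {d : ℕ} {T : SimpleGraph V} (hT : T.IsTree) (ι : LegalColoring T d)
    (σ : V → Equiv.Perm (Fin d)) (x0 y0 : V) : devMap hT ι σ x0 y0 x0 = y0 := by
  rw [devMap]; simp

theorem devMap_step {d : ℕ} {T : SimpleGraph V} (hT : T.IsTree) (ι : LegalColoring T d)
    (σ : V → Equiv.Perm (Fin d)) (x0 y0 : V) (v w : V) (hvw : T.Adj v w)
    (hd : T.dist x0 v + 1 = T.dist x0 w) :
    devMap hT ι σ x0 y0 w = step ι (devMap hT ι σ x0 y0 v) (σ v (ι.color v w)) := by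
  have hne : x0 ≠ w := by
    rintro rfl
    simp at hd
  have hs := (parent_exists hT x0 w hne).choose_spec
  have : (parent_exists hT x0 w hne).choose = v := parent_unique hT hs.1 hvw hs.2 hd
  conv_lhs => rw [devMap]
  rw [dif_neg hne, this]

theorem exists_aut {d : ℕ} {T : SimpleGraph V} (hT : T.IsTree) (ι : LegalColoring T d)
    (σ : V → Equiv.Perm (Fin d))
    (hσ : ∀ v w, T.Adj v w → σ v (ι.color v w) = σ w (ι.color v w)) (x0 y0 : V) :
    ∃ h : T ≃g T, h x0 = y0 ∧ ∀ v w, T.Adj v w → σ v (ι.color v w) = ι.color (h v) (h w) := by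
  set f := devMap hT ι σ x0 y0 with hf
  have h1 : ∀ v w, T.Adj v w → T.dist x0 v + 1 = T.dist x0 w →
      T.Adj (f v) (f w) ∧ σ v (ι.color v w) = ι.color (f v) (f w) := by
    intro v w hvw hd
    have := devMap_step hT ι σ x0 y0 v w hvw hd
    rw [← hf] at this
    rw [this]
    exact ⟨step_adj _ _ _, (step_color _ _ _).symm⟩
  have h2 : ∀ v w, T.Adj v w →
      T.Adj (f v) (f w) ∧ σ v (ι.color v w) = ι.color (f v) (f w) := by
    intro v w hvw
    rcases hT.dist_eq_dist_add_one_of_adj x0 hvw with h | h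
    · obtain ⟨ha, hb⟩ := h1 w v hvw.symm h.symm
      refine ⟨ha.symm, ?_⟩
      rw [ι.symm _ _ ha.symm, ← hb, hσ v w hvw, ι.symm _ _ hvw]
    · exact h1 v w hvw h.symm
  have hloc : ∀ v w w', T.Adj v w → T.Adj v w' → f w = f w' → w = w' := by
    intro v w w' h h' e
    have e1 := (h2 v w h).2
    have e2 := (h2 v w' h').2
    rw [e, ← e2] at e1
    exact color_inj ι h h' ((σ v).injective e1)
  have hdist : ∀ n u v, T.dist u v = n → T.dist (f u) (f v) = n := by
    intro n
    induction n using Nat.strong_induction_on with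
    | _ n ih =>
      intro u v huv
      by_cases huv' : u = v
      · subst huv'; simp at huv ⊢; exact huv
      · obtain ⟨w, hwv, hw⟩ := parent_exists hT u v huv'
        have iw := ih (T.dist u w) (by omega) u w rfl
        by_cases huw : u = w
        · subst huw
          have := SimpleGraph.dist_eq_one_iff_adj.mpr (h2 _ _ hwv).1
          rw [SimpleGraph.dist_self] at hw
          omega
        · obtain ⟨z, hzw, hz⟩ := parent_exists hT u w huw
          have iz := ih (T.dist u z) (by omega) u z rfl
          rcases hT.dist_eq_dist_add_one_of_adj (f u) (h2 _ _ hwv).1 with h | h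
          · exfalso
            have e := parent_unique hT (u := f u) (h2 _ _ hzw).1 (h2 _ _ hwv).1.symm (by omega)
              (by omega)
            have := hloc w z v hzw.symm hwv e
            subst this
            omega
          · omega
  have hinj : Function.Injective f := by
    intro u v huv
    have := hdist _ u v rfl
    rw [huv, SimpleGraph.dist_self] at this
    exact hT.connected.dist_eq_zero_iff.mp this.symm
  have hsurj : Function.Surjective f := by
    intro y
    refine conn_ind hT (fun y => ∃ x, f x = y) y0 ⟨x0, devMap_base _ _ _ _ _⟩ ?_ y
    rintro v w hvw ⟨x, rfl⟩
    refine ⟨step ι x ((σ x).symm (ι.color (f x) w)), ?_⟩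
    have := h2 x _ (step_adj ι x ((σ x).symm (ι.color (f x) w)))
    rw [step_color, Equiv.apply_symm_apply] at this
    exact color_inj ι this.1 hvw this.2.symm
  refine ⟨⟨Equiv.ofBijective f ⟨hinj, hsurj⟩, ?_⟩, devMap_base _ _ _ _ _, fun v w h => (h2 v w h).2⟩
  intro a b
  change T.Adj (f a) (f b) ↔ T.Adj a b
  rw [← SimpleGraph.dist_eq_one_iff_adj, ← SimpleGraph.dist_eq_one_iff_adj, hdist _ a b rfl]

/-! ### The group `U(F)` -/

def UF {d : ℕ} (T : SimpleGraph V) (F : Subgroup (Equiv.Perm (Fin d)))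
    (ι : LegalColoring T d) : Subgroup (T ≃g T) where
  carrier := {g | InUF T F ι g}
  one_mem' := fun x => ⟨1, F.one_mem, fun y _ => rfl⟩
  mul_mem' := by
    intro a b ha hb x
    obtain ⟨σ, hσ, h1⟩ := hb x
    obtain ⟨τ, hτ, h2⟩ := ha (b x)
    refine ⟨τ * σ, F.mul_mem hτ hσ, fun y hxy => ?_⟩
    rw [Equiv.Perm.mul_apply, h1 y hxy, h2 _ (b.map_adj_iff.mpr hxy)]
    rfl
  inv_mem' := by
    intro a ha x
    obtain ⟨σ, hσ, h1⟩ := ha (a⁻¹ x)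
    refine ⟨σ⁻¹, F.inv_mem hσ, fun y hxy => ?_⟩
    have := h1 (a⁻¹ y) ((a⁻¹).map_adj_iff.mpr hxy)
    rw [Equiv.Perm.inv_eq_iff_eq, this]
    have e : ∀ z, a (a⁻¹ z) = z := fun z => a.apply_symm_apply z
    rw [e, e]

theorem UFplus_le {d : ℕ} (T : SimpleGraph V) (F : Subgroup (Equiv.Perm (Fin d)))
    (ι : LegalColoring T d) : UFplus T F ι ≤ UF T F ι := by
  unfold UFplus
  rw [Subgroup.closure_le]
  intro g hg
  exact hg.1

theorem UFplus_even {d : ℕ} {T : SimpleGraph V} (hT : T.IsTree) (F : Subgroup (Equiv.Perm (Fin d)))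
    (ι : LegalColoring T d) (g : T ≃g T) (hg : g ∈ UFplus T F ι) : ∀ x, Even (T.dist x (g x)) := by
  unfold UFplus at hg
  induction hg using Subgroup.closure_induction with
  | mem g hg =>
    obtain ⟨-, x, y, -, hx, -⟩ := hg
    intro z
    have h1 := dist_parity hT z x (g z)
    have h2 := iso_dist_eq T g x z
    rw [hx] at h2
    rw [h2, SimpleGraph.dist_comm (u := z) (v := x)] at h1
    rw [Nat.even_iff] at h1 ⊢
    omega
  | one => intro x; exact ⟨0, T.dist_self⟩
  | mul a b _ _ ha hb =>
    intro x
    have h1 := dist_parity hT x (b x) (a (b x))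
    have h2 := ha (b x)
    have h3 := hb x
    change Even (T.dist x (a (b x)))
    rw [Nat.even_iff] at *
    omega
  | inv a _ ha =>
    intro x
    have := ha (a⁻¹ x)
    have e : ∀ z, a (a⁻¹ z) = z := fun z => a.apply_symm_apply z
    rwa [e, SimpleGraph.dist_comm] at this

theorem exists_fix {d : ℕ} {T : SimpleGraph V} (hT : T.IsTree) (F : Subgroup (Equiv.Perm (Fin d)))
    (ι : LegalColoring T d) (hgen : GenByPointStabilizers F) (x : V)
    (σ : Equiv.Perm (Fin d)) (hσ : σ ∈ F) :
    ∃ k ∈ UFplus T F ι, k x = x ∧ ∀ y, T.Adj x y → σ (ι.color x y) = ι.color x (k y) := by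
  have hgen' := hgen
  unfold GenByPointStabilizers at hgen'
  rw [hgen'] at hσ
  induction hσ using Subgroup.closure_induction with
  | mem σ hs =>
    obtain ⟨hF, i, hi⟩ := hs
    obtain ⟨k, hk, hc⟩ := exists_aut hT ι (fun _ => σ) (fun _ _ _ => rfl) x x
    refine ⟨k, Subgroup.subset_closure ⟨fun v => ⟨σ, hF, fun w h => hc v w h⟩, x, step ι x i,
      step_adj _ _ _, hk, ?_⟩, hk, fun y hy => by rw [hc x y hy, hk]⟩
    have h1 := hc x _ (step_adj ι x i)
    have h2 : T.Adj (k x) (k (step ι x i)) := k.map_adj_iff.mpr (step_adj ι x i)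
    rw [hk] at h1 h2
    refine color_inj ι h2 (step_adj ι x i) ?_
    rw [← h1, step_color, hi]
  | one => exact ⟨1, Subgroup.one_mem _, rfl, fun _ _ => rfl⟩
  | mul a b _ _ ha hb =>
    obtain ⟨k, hk, hkx, h1⟩ := ha
    obtain ⟨l, hl, hlx, h2⟩ := hb
    refine ⟨k * l, Subgroup.mul_mem _ hk hl, by change k (l x) = x; rw [hlx, hkx], fun y hy => ?_⟩
    have : T.Adj (l x) (l y) := l.map_adj_iff.mpr hy
    rw [hlx] at this
    rw [Equiv.Perm.mul_apply, h2 y hy, h1 _ this]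
    rfl
  | inv a _ ha =>
    obtain ⟨k, hk, hkx, h1⟩ := ha
    have e : ∀ z, k (k⁻¹ z) = z := fun z => k.apply_symm_apply z
    have hx : k⁻¹ x = x := by
      apply k.injective; rw [e, hkx]
    refine ⟨k⁻¹, Subgroup.inv_mem _ hk, hx, fun y hy => ?_⟩
    have h3 : T.Adj (k⁻¹ x) (k⁻¹ y) := (k⁻¹).map_adj_iff.mpr hy
    rw [hx] at h3
    rw [Equiv.Perm.inv_eq_iff_eq, h1 _ h3, e]

theorem stab_le {d : ℕ} {T : SimpleGraph V} (hd : 3 ≤ d) (hT : T.IsTree)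
    (F : Subgroup (Equiv.Perm (Fin d)))
    (ι : LegalColoring T d) (hgen : GenByPointStabilizers F) (x : V) (g : T ≃g T)
    (hg : g ∈ UF T F ι) (hx : g x = x) : g ∈ UFplus T F ι := by
  obtain ⟨σ, hσ, h1⟩ := hg x
  obtain ⟨k, hk, hkx, h2⟩ := exists_fix hT F ι hgen x σ hσ
  have h3 : k⁻¹ * g ∈ UFplus T F ι := by
    have e : ∀ z, k⁻¹ (k z) = z := fun z => k.symm_apply_apply z
    have hy := step_adj ι x ⟨0, by omega⟩
    refine Subgroup.subset_closure ⟨(UF T F ι).mul_mem ((UF T F ι).inv_mem (UFplus_le T F ι hk)) hg,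
      x, _, hy, ?_, ?_⟩
    · change k⁻¹ (g x) = x
      conv_lhs => rw [hx, ← hkx, e]
    · change k⁻¹ (g _) = _
      have h4 := h1 _ hy
      have h5 := h2 _ hy
      have h6 := g.map_adj_iff.mpr hy
      have h7 := k.map_adj_iff.mpr hy
      rw [hx] at h4 h6
      rw [hkx] at h7
      rw [color_inj ι h6 h7 (by rw [← h4, h5]), e]
  have := Subgroup.mul_mem _ hk h3
  rwa [mul_inv_cancel_left] at this

theorem even_trans {d : ℕ} {T : SimpleGraph V} (hT : T.IsTree)
    (F : Subgroup (Equiv.Perm (Fin d))) (htrans : PermTransitive F)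
    (ι : LegalColoring T d) (hgen : GenByPointStabilizers F) (x : V) (n : ℕ) :
    ∀ y, T.dist x y = 2 * n → ∃ k ∈ UFplus T F ι, k x = y := by
  induction n with
  | zero =>
    intro y hy
    exact ⟨1, Subgroup.one_mem _, hT.connected.dist_eq_zero_iff.mp hy⟩
  | succ n ih =>
    intro y hy
    obtain ⟨z, hz, hz'⟩ := parent_exists hT x y (by rintro rfl; simp at hy)
    obtain ⟨w, hw, hw'⟩ := parent_exists hT x z (by rintro rfl; simp at hz'; omega)
    obtain ⟨k, hk, hkw⟩ := ih w (by omega)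
    obtain ⟨σ, hσ, hs⟩ := htrans (ι.color z w) (ι.color z y)
    obtain ⟨l, hl, hlz, h1⟩ := exists_fix hT F ι hgen z σ hσ
    refine ⟨l * k, Subgroup.mul_mem _ hl hk, ?_⟩
    change l (k x) = y
    rw [hkw]
    have h2 := h1 w hw.symm
    have h3 := l.map_adj_iff.mpr hw.symm
    rw [hlz] at h3
    refine color_inj ι h3 hz ?_
    rw [← h2, hs]

theorem mem_UFplus {d : ℕ} {T : SimpleGraph V} (hd : 3 ≤ d) (hT : T.IsTree)
    (F : Subgroup (Equiv.Perm (Fin d))) (htrans : PermTransitive F)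
    (ι : LegalColoring T d) (hgen : GenByPointStabilizers F) (x : V) (g : T ≃g T)
    (hg : g ∈ UF T F ι) (hx : Even (T.dist x (g x))) : g ∈ UFplus T F ι := by
  obtain ⟨n, hn⟩ := hx
  obtain ⟨k, hk, hkx⟩ := even_trans hT F htrans ι hgen x n (g x) (by omega)
  have h3 : k⁻¹ * g ∈ UFplus T F ι := by
    refine stab_le hd hT F ι hgen x _
      ((UF T F ι).mul_mem ((UF T F ι).inv_mem (UFplus_le T F ι hk)) hg) ?_
    change k⁻¹ (g x) = x
    rw [← hkx]
    exact k.symm_apply_apply x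
  have := Subgroup.mul_mem _ hk h3
  rwa [mul_inv_cancel_left] at this


/-! ### Projection to a line -/

theorem no_local_max {T : SimpleGraph V} (hT : T.IsTree) (L : GeodLine T) (v : V) (i : ℤ)
    (h : T.dist v (L.seq (i + 1)) = T.dist v (L.seq i) + 1) :
    T.dist v (L.seq (i + 1 + 1)) = T.dist v (L.seq (i + 1)) + 1 := by
  rcases hT.dist_eq_dist_add_one_of_adj v (L.adj (i + 1)) with h' | h'
  · have := L.inj (parent_unique hT (u := v) (L.adj i) (L.adj (i + 1)).symm h.symm h'.symm)
    omega
  · exact h'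

theorem no_local_max' {T : SimpleGraph V} (hT : T.IsTree) (L : GeodLine T) (v : V) (i : ℤ)
    (h : T.dist v (L.seq (i - 1)) = T.dist v (L.seq i) + 1) :
    T.dist v (L.seq (i - 1 - 1)) = T.dist v (L.seq (i - 1)) + 1 := by
  have a1 := L.adj (i - 1)
  have a2 := L.adj (i - 1 - 1)
  rw [sub_add_cancel] at a1 a2
  rcases hT.dist_eq_dist_add_one_of_adj v a2 with h' | h'
  · exact h'
  · have := L.inj (parent_unique hT (u := v) a1.symm a2 h.symm h'.symm)
    omega

theorem proj_exists {T : SimpleGraph V} (hT : T.IsTree) (L : GeodLine T) (v : V) :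
    ∃ p : ℤ, ∀ i, T.dist v (L.seq i) = T.dist v (L.seq p) + (i - p).natAbs := by
  obtain ⟨p, hp⟩ : ∃ p, ∀ i, T.dist v (L.seq p) ≤ T.dist v (L.seq i) :=
    ⟨Function.argmin (fun i => T.dist v (L.seq i)),
      fun i => Function.argmin_le (fun i => T.dist v (L.seq i)) i⟩
  refine ⟨p, ?_⟩
  have hf : ∀ k : ℕ, T.dist v (L.seq (p + k)) = T.dist v (L.seq p) + k ∧
      T.dist v (L.seq (p + k + 1)) = T.dist v (L.seq (p + k)) + 1 := by
    intro k
    induction k with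
    | zero =>
      refine ⟨by simp, ?_⟩
      have := hT.dist_eq_dist_add_one_of_adj v (L.adj p)
      have := hp (p + 1)
      simp only [Nat.cast_zero, add_zero]
      omega
    | succ k ih =>
      push_cast
      rw [← add_assoc]
      have := no_local_max hT L v _ ih.2
      omega
  have hb : ∀ k : ℕ, T.dist v (L.seq (p - k)) = T.dist v (L.seq p) + k ∧
      T.dist v (L.seq (p - k - 1)) = T.dist v (L.seq (p - k)) + 1 := by
    intro k
    induction k with
    | zero =>
      refine ⟨by simp, ?_⟩
      have h1 := hT.dist_eq_dist_add_one_of_adj v (L.adj (p - 1))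
      have := hp (p - 1)
      rw [sub_add_cancel] at h1
      simp only [Nat.cast_zero, sub_zero]
      omega
    | succ k ih =>
      push_cast
      rw [← sub_sub]
      have := no_local_max' hT L v _ ih.2
      omega
  intro i
  rcases le_total p i with h | h
  · obtain ⟨k, rfl⟩ := Int.le.dest h
    rw [(hf k).1]; omega
  · obtain ⟨k, hk⟩ := Int.le.dest h
    obtain rfl : i = p - k := by omega
    rw [(hb k).1]; omega

noncomputable def pr {T : SimpleGraph V} (hT : T.IsTree) (L : GeodLine T) (v : V) : ℤ :=
  (proj_exists hT L v).choose

theorem pr_spec {T : SimpleGraph V} (hT : T.IsTree) (L : GeodLine T) (v : V) (i : ℤ) :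
    T.dist v (L.seq i) = T.dist v (L.seq (pr hT L v)) + (i - pr hT L v).natAbs :=
  (proj_exists hT L v).choose_spec i

theorem pr_unique {T : SimpleGraph V} (hT : T.IsTree) (L : GeodLine T) (v : V) (q : ℤ)
    (h : ∀ i, T.dist v (L.seq q) ≤ T.dist v (L.seq i)) : pr hT L v = q := by
  have h1 := pr_spec hT L v q
  have h2 := h (pr hT L v)
  omega

theorem pr_seq {T : SimpleGraph V} (hT : T.IsTree) (L : GeodLine T) (i : ℤ) :
    pr hT L (L.seq i) = i := by
  apply pr_unique
  intro j
  rw [SimpleGraph.dist_self]; omega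

theorem pr_adj_aux {T : SimpleGraph V} (hT : T.IsTree) (L : GeodLine T) {v w : V}
    (hvw : T.Adj v w) (hlt : pr hT L v < pr hT L w) :
    v = L.seq (pr hT L v) ∧ w = L.seq (pr hT L w) := by
  have hv := pr_spec hT L v
  have hw := pr_spec hT L w
  set p := pr hT L v
  set q := pr hT L w
  have hd : ∀ i, T.dist v (L.seq i) = T.dist w (L.seq i) + 1 ∨
      T.dist w (L.seq i) = T.dist v (L.seq i) + 1 := by
    intro i
    have := hT.dist_eq_dist_add_one_of_adj (L.seq i) hvw
    rwa [SimpleGraph.dist_comm (u := L.seq i), SimpleGraph.dist_comm (u := L.seq i)] at this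
  have a1 := hv q
  have a2 := hw p
  have a3 := hd p
  have a4 := hd q
  have hD : T.dist v (L.seq p) = T.dist w (L.seq q) := by omega
  have hz : T.dist v (L.seq p) = 0 := by
    by_contra hne
    have hne' : L.seq p ≠ v := by
      intro e; apply hne; rw [e, SimpleGraph.dist_self]
    obtain ⟨z, hz, hz'⟩ := parent_exists hT (L.seq p) v hne'
    have b1 := hT.dist_eq_dist_add_one_of_adj (L.seq q) hz
    have b2 : T.dist (L.seq q) z ≤ T.dist (L.seq q) (L.seq p) + T.dist (L.seq p) z :=
      hT.connected.dist_triangle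
    have b3 := L.geodesic q p
    have e : z = w := by
      apply parent_unique hT (u := L.seq q) hz hvw.symm
      · rw [SimpleGraph.dist_comm (v := v)] at hz' b1 ⊢
        omega
      · rw [SimpleGraph.dist_comm (v := w), SimpleGraph.dist_comm (v := v)]
        omega
    subst e
    rw [SimpleGraph.dist_comm (v := v), SimpleGraph.dist_comm (v := z)] at hz'
    omega
  exact ⟨hT.connected.dist_eq_zero_iff.mp hz, hT.connected.dist_eq_zero_iff.mp (hD ▸ hz)⟩

theorem pr_adj {T : SimpleGraph V} (hT : T.IsTree) (L : GeodLine T) {v w : V}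
    (hvw : T.Adj v w) : pr hT L v = pr hT L w ∨
    (v = L.seq (pr hT L v) ∧ w = L.seq (pr hT L w)) := by
  rcases lt_trichotomy (pr hT L v) (pr hT L w) with h | h | h
  · exact Or.inr (pr_adj_aux hT L hvw h)
  · exact Or.inl h
  · exact Or.inr (pr_adj_aux hT L hvw.symm h).symm

theorem pr_equiv {T : SimpleGraph V} (hT : T.IsTree) (L : GeodLine T) (g : T ≃g T) (a : ℤ)
    (hg : ∀ i, g (L.seq i) = L.seq (i + a)) (v : V) : pr hT L (g v) = pr hT L v + a := by
  apply pr_unique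
  intro i
  have h1 := hg (i - a)
  rw [sub_add_cancel] at h1
  rw [← hg, ← h1, iso_dist_eq, iso_dist_eq]
  have := pr_spec hT L v (i - a)
  omega

open Classical in
theorem pr_dist {T : SimpleGraph V} (hT : T.IsTree) (L : GeodLine T) (v w : V)
    (hne : pr hT L v ≠ pr hT L w) :
    T.dist v (L.seq (pr hT L v)) + (pr hT L v - pr hT L w).natAbs + T.dist w (L.seq (pr hT L w))
      ≤ T.dist v w := by
  set q := pr hT L w with hq
  set E := T.dist w (L.seq q) with hE
  let f : V → ℤ := fun x => if pr hT L x = q then (E : ℤ) - T.dist x (L.seq q)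
    else T.dist x (L.seq (pr hT L x)) + (pr hT L x - q).natAbs + E
  have hf : ∀ x y, T.Adj x y → f x ≤ f y + 1 := by
    intro x y hxy
    have hd : ∀ i, T.dist x (L.seq i) = T.dist y (L.seq i) + 1 ∨
        T.dist y (L.seq i) = T.dist x (L.seq i) + 1 := by
      intro i
      have := hT.dist_eq_dist_add_one_of_adj (L.seq i) hxy
      rwa [SimpleGraph.dist_comm (u := L.seq i), SimpleGraph.dist_comm (u := L.seq i)] at this
    rcases pr_adj hT L hxy with h | ⟨h1, h2⟩
    · have := hd (pr hT L y)
      by_cases hy : pr hT L y = q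
      · simp only [f, h, hy, if_true]
        rw [hy] at this
        omega
      · simp only [f, h, hy, if_false]
        omega
    · have h3 : T.Adj (L.seq (pr hT L x)) (L.seq (pr hT L y)) := by rw [← h1, ← h2]; exact hxy
      have h4 := L.adj_iff h3
      have h5 : T.dist x (L.seq (pr hT L x)) = 0 := by rw [← h1]; simp
      have h6 : T.dist y (L.seq (pr hT L y)) = 0 := by rw [← h2]; simp
      by_cases hx : pr hT L x = q
      · have hy : pr hT L y ≠ q := by omega
        simp only [f, hx, hy, if_true, if_false]
        omega
      · by_cases hy : pr hT L y = q
        · simp only [f, hx, hy, if_true, if_false]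
          rw [hy] at h6
          omega
        · simp only [f, hx, hy, if_false]
          omega
  have := lip_le hT f hf v w
  have e1 : f w = 0 := by simp [f, hq, hE]
  have e2 : f v = T.dist v (L.seq (pr hT L v)) + (pr hT L v - q).natAbs + E := by
    simp only [f, hne, if_false]
  rw [e1, e2] at this
  omega

theorem axis_dist {T : SimpleGraph V} (hT : T.IsTree) (L : GeodLine T) (g : T ≃g T) (a : ℕ)
    (ha : 0 < a) (hg : ∀ i, g (L.seq i) = L.seq (i + a)) (v : V) :
    a + 2 * T.dist v (L.seq (pr hT L v)) ≤ T.dist v (g v) := by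
  have h1 := pr_equiv hT L g a hg v
  have h2 := pr_dist hT L v (g v) (by omega)
  rw [h1, ← hg, iso_dist_eq] at h2
  omega

theorem axis_transLen {T : SimpleGraph V} (hT : T.IsTree) (L : GeodLine T) (g : T ≃g T) (a : ℕ)
    (ha : 0 < a) (hg : ∀ i, g (L.seq i) = L.seq (i + a)) : transLen T g = a := by
  unfold transLen
  apply le_antisymm
  · apply Nat.sInf_le
    refine ⟨L.seq 0, ?_⟩
    simp only
    rw [hg, L.geodesic]
    omega
  · obtain ⟨v, hv⟩ := Nat.sInf_mem (s := Set.range fun x : V => T.dist x (g x)) ⟨_, L.seq 0, rfl⟩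
    rw [← hv]
    have := axis_dist hT L g a ha hg v
    simp only
    omega

theorem axis_pow {T : SimpleGraph V} (L : GeodLine T) (g : T ≃g T) (a : ℤ)
    (hg : ∀ i, g (L.seq i) = L.seq (i + a)) (n : ℕ) (i : ℤ) :
    (g ^ n) (L.seq i) = L.seq (i + n * a) := by
  induction n generalizing i with
  | zero => simp
  | succ n ih =>
    rw [pow_succ]
    change (g ^ n) (g (L.seq i)) = _
    rw [hg, ih]
    congr 1
    push_cast; ring

theorem axis_zpow {T : SimpleGraph V} (L : GeodLine T) (g : T ≃g T) (a : ℤ)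
    (hg : ∀ i, g (L.seq i) = L.seq (i + a)) (n : ℤ) (i : ℤ) :
    (g ^ n) (L.seq i) = L.seq (i + n * a) := by
  rcases Int.eq_nat_or_neg n with ⟨m, rfl | rfl⟩
  · rw [zpow_natCast]; exact axis_pow L g a hg m i
  · rw [zpow_neg, zpow_natCast]
    apply (g ^ m).injective
    have e : ∀ z, (g ^ m) ((g ^ m)⁻¹ z) = z := fun z => (g ^ m).apply_symm_apply z
    rw [e, axis_pow L g a hg]
    congr 1
    ring

/-- existence of an axis -/
theorem exists_axis {T : SimpleGraph V} (hT : T.IsTree) (g : T ≃g T) (h2 : 2 ≤ transLen T g) :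
    ∃ L : GeodLine T, ∀ i, g (L.seq i) = L.seq (i + transLen T g) := by
  have hmin : ∀ y, transLen T g ≤ T.dist y (g y) := fun y => Nat.sInf_le ⟨y, rfl⟩
  obtain ⟨x0⟩ := hT.connected.nonempty
  obtain ⟨x, hx⟩ := Nat.sInf_mem (s := Set.range fun x : V => T.dist x (g x)) ⟨_, x0, rfl⟩
  change T.dist x (g x) = transLen T g at hx
  set l := transLen T g with hl
  obtain ⟨p, hp⟩ := hT.connected.exists_walk_length_eq_dist x (g x)
  set z := p.getVert with hz
  have hz0 : z 0 = x := p.getVert_zero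
  have hzl : z l = g x := by rw [← hx, ← hp]; exact p.getVert_length
  have hzadj : ∀ r, r < l → T.Adj (z r) (z (r + 1)) := fun r hr =>
    p.adj_getVert_succ (by omega)
  have hzd : ∀ r, r ≤ l → T.dist x (z r) ≤ r := by
    intro r
    induction r with
    | zero => intro _; rw [hz0]; simp
    | succ r ih =>
      intro hr
      have := ih (by omega)
      have := hT.dist_eq_dist_add_one_of_adj x (hzadj r (by omega))
      omega
  have hzd' : ∀ k r, r ≤ l → k + r = l → T.dist (z r) (g x) ≤ k := by
    intro k
    induction k with
    | zero => intro r _ h; rw [← hzl, show r = l by omega]; simp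
    | succ k ih =>
      intro r hr h
      have a1 := ih (r + 1) (by omega) (by omega)
      have a2 := hT.dist_eq_dist_add_one_of_adj (g x) (hzadj r (by omega))
      rw [SimpleGraph.dist_comm (u := g x), SimpleGraph.dist_comm (u := g x)] at a2
      omega
  have hzne : ∀ r, r + 2 ≤ l → z r ≠ z (r + 2) := by
    intro r hr e
    have a1 := hzd r (by omega)
    have a2 := hzd' (l - (r + 2)) (r + 2) hr (by omega)
    have a3 : T.dist x (g x) ≤ T.dist x (z r) + T.dist (z r) (g x) := hT.connected.dist_triangle
    rw [← e] at a2
    omega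
  have hjun : z (l - 1) ≠ g (z 1) := by
    intro e
    have a0 := hmin (z 1)
    rw [← e] at a0
    have a1 : T.dist (g x) (z (l - 1)) = 1 := by
      rw [e, iso_dist_eq]
      have := hzadj 0 (by omega)
      rw [hz0] at this
      exact SimpleGraph.dist_eq_one_iff_adj.mpr this
    have key : ∀ k, k + 1 ≤ l → T.dist (z 1) (z (k + 1)) ≤ k := by
      intro k
      induction k with
      | zero => intro _; simp
      | succ k ih =>
        intro hk
        have := ih (by omega)
        have := hT.dist_eq_dist_add_one_of_adj (z 1) (hzadj (k + 1) (by omega))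
        omega
    have := key (l - 2) (by omega)
    rw [show l - 2 + 1 = l - 1 by omega] at this
    omega
  let L : ℤ → V := fun i => (g ^ (i / l)) (z (i % l).toNat)
  have hmulg : ∀ (q : ℤ) (y : V), (g ^ (q + 1)) y = (g ^ q) (g y) := by
    intro q y
    rw [zpow_add_one]; rfl
  have hrep : ∀ (q : ℤ) (r : ℕ), r ≤ l → L (q * l + r) = (g ^ q) (z r) := by
    intro q r hr
    rcases Nat.lt_or_ge r l with h | h
    · have e1 : (q * l + r) / (l : ℤ) = q := by
        rw [add_comm, Int.add_mul_ediv_right _ _ (by omega), Int.ediv_eq_zero_of_lt (by omega) (by omega)]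
        simp
      have e2 : (q * l + r) % (l : ℤ) = r := by
        rw [add_comm, Int.add_mul_emod_self_right, Int.emod_eq_of_lt (by omega) (by omega)]
      simp only [L, e1, e2, Int.toNat_natCast]
    · have hrl : r = l := by omega
      rw [hrl]
      have e1 : (q * l + l) / (l : ℤ) = q + 1 := by
        rw [show q * (l : ℤ) + l = (q + 1) * l by ring, Int.mul_ediv_cancel _ (by omega)]
      have e2 : (q * l + l) % (l : ℤ) = 0 := by
        rw [show q * (l : ℤ) + l = (q + 1) * l by ring, Int.mul_emod_left]
      simp only [L, e1, e2, Int.toNat_zero]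
      rw [hz0, hmulg, hzl]
  have hdec : ∀ i : ℤ, ∃ (q : ℤ) (r : ℕ), r < l ∧ i = q * l + r := by
    intro i
    refine ⟨i / l, (i % l).toNat, ?_, ?_⟩
    · have := Int.emod_lt_of_pos i (b := l) (by omega)
      have := Int.emod_nonneg i (b := l) (by omega)
      omega
    · have := Int.emod_nonneg i (b := l) (by omega)
      rw [Int.toNat_of_nonneg this]
      have := Int.mul_ediv_add_emod i l
      rw [mul_comm] at this
      omega
  have hLadj : ∀ i, T.Adj (L i) (L (i + 1)) := by
    intro i
    obtain ⟨q, r, hr, rfl⟩ := hdec i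
    have e : q * (l : ℤ) + r + 1 = q * l + (r + 1 : ℕ) := by push_cast; ring
    rw [e, hrep _ _ hr.le, hrep _ _ hr]
    exact (g ^ q).map_adj_iff.mpr (hzadj r hr)
  have hLne : ∀ i, L i ≠ L (i + 2) := by
    intro i
    obtain ⟨q, r, hr, rfl⟩ := hdec i
    rw [hrep _ _ hr.le]
    by_cases h : r + 2 ≤ l
    · have e : q * (l : ℤ) + r + 2 = q * l + (r + 2 : ℕ) := by push_cast; ring
      rw [e, hrep _ _ h]
      intro h'
      exact hzne r h ((g ^ q).injective h')
    · have e : q * (l : ℤ) + r + 2 = (q + 1) * l + (1 : ℕ) := by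
        have : (r : ℤ) + 1 = l := by omega
        push_cast; rw [← this]; ring
      rw [e, hrep _ _ (by omega), hmulg]
      intro h'
      have h'' := (g ^ q).injective h'
      rw [show r = l - 1 by omega] at h''
      exact hjun h''
  refine ⟨mkLine hT L hLadj hLne, ?_⟩
  intro i
  change g (L i) = L (i + l)
  obtain ⟨q, r, hr, rfl⟩ := hdec i
  have e : q * (l : ℤ) + r + l = (q + 1) * l + r := by ring
  rw [e, hrep _ _ hr.le, hrep _ _ hr.le, add_comm, zpow_one_add]
  rfl

/-- extension along lines -/
theorem extend_line {d : ℕ} {T : SimpleGraph V} (hT : T.IsTree) (ι : LegalColoring T d)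
    (F : Subgroup (Equiv.Perm (Fin d))) (h2 : PermTwoTransitive F) (L L' : GeodLine T) :
    ∃ h ∈ UF T F ι, ∀ i, h (L.seq i) = L'.seq i := by
  have key : ∀ i : ℤ, ∃ σ ∈ F,
      σ (ι.color (L.seq (i - 1)) (L.seq (i - 1 + 1))) =
        ι.color (L'.seq (i - 1)) (L'.seq (i - 1 + 1)) ∧
      σ (ι.color (L.seq i) (L.seq (i + 1))) = ι.color (L'.seq i) (L'.seq (i + 1)) := by
    intro i
    have a := line_color_ne ι L (i - 1)
    have b := line_color_ne ι L' (i - 1)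
    simp only [sub_add_cancel] at a b ⊢
    exact h2 _ _ _ _ a b
  choose s hsF hs1 hs2 using key
  have hs : ∀ i, s i (ι.color (L.seq i) (L.seq (i + 1))) =
      s (i + 1) (ι.color (L.seq i) (L.seq (i + 1))) := by
    intro i
    have := hs1 (i + 1)
    rw [add_sub_cancel_right] at this
    rw [this, hs2]
  obtain ⟨h, h0, hc⟩ := exists_aut hT ι (fun v => s (pr hT L v)) (by
    intro v w hvw
    rcases pr_adj hT L hvw with e | ⟨e1, e2⟩
    · simp only [e]
    · have h3 : T.Adj (L.seq (pr hT L v)) (L.seq (pr hT L w)) := by rw [← e1, ← e2]; exact hvw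
      conv_lhs => rw [e1, e2, pr_seq]
      conv_rhs => rw [e1, e2, pr_seq]
      rcases L.adj_iff h3 with e | e
      · rw [e]; exact hs _
      · rw [ι.symm _ _ h3, e]; exact (hs _).symm) (L.seq 0) (L'.seq 0)
  refine ⟨h, fun v => ⟨_, hsF _, hc v⟩, ?_⟩
  refine line_track ι L L' h h0 ?_
  intro i
  rw [← hc _ _ (L.adj i), pr_seq, hs2]


def GeodLine.shift {T : SimpleGraph V} (L : GeodLine T) (a : ℤ) : GeodLine T where
  seq := fun i => L.seq (i + a)
  adj := fun n => by
    have := L.adj (n + a)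
    rwa [show n + a + 1 = n + 1 + a by ring] at this
  geodesic := fun m n => by rw [L.geodesic]; congr 1; ring

def GeodLine.toRay {T : SimpleGraph V} (L : GeodLine T) : GeodRay T where
  seq := fun n => L.seq n
  adj := fun n => L.adj n
  geodesic := fun m n => by rw [L.geodesic, Nat.dist]; omega

theorem piecewise_aut {T : SimpleGraph V} (hT : T.IsTree) (L : GeodLine T) (K : ℤ → (T ≃g T))
    (hK : ∀ m i, K m (L.seq i) = L.seq i) :
    ∃ u : T ≃g T, ∀ v, u v = K (pr hT L v) v := by
  have e : ∀ m z, K m ((K m)⁻¹ z) = z := fun m z => (K m).apply_symm_apply z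
  have e' : ∀ m z, (K m)⁻¹ (K m z) = z := fun m z => (K m).symm_apply_apply z
  have hK' : ∀ m i, (K m)⁻¹ (L.seq i) = L.seq i := by
    intro m i
    apply (K m).injective
    rw [e, hK]
  have pK : ∀ m v, pr hT L (K m v) = pr hT L v := by
    intro m v
    rw [pr_equiv hT L (K m) 0 (by intro i; rw [hK, add_zero]), add_zero]
  have pK' : ∀ m v, pr hT L ((K m)⁻¹ v) = pr hT L v := by
    intro m v
    rw [pr_equiv hT L (K m)⁻¹ 0 (by intro i; rw [hK', add_zero]), add_zero]
  have hadj : ∀ (K : ℤ → (T ≃g T)), (∀ m i, K m (L.seq i) = L.seq i) → ∀ v w, T.Adj v w →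
      T.Adj (K (pr hT L v) v) (K (pr hT L w) w) := by
    intro K hK v w hvw
    have : K (pr hT L w) w = K (pr hT L v) w := by
      rcases pr_adj hT L hvw with h | ⟨-, h⟩
      · rw [h]
      · generalize pr hT L w = j at h ⊢
        rw [h, hK, hK]
    rw [this]
    exact (K _).map_adj_iff.mpr hvw
  refine ⟨⟨⟨fun v => K (pr hT L v) v, fun v => (K (pr hT L v))⁻¹ v, ?_, ?_⟩, ?_⟩, fun v => rfl⟩
  · intro v
    simp only
    rw [pK, e']
  · intro v
    simp only
    rw [pK', e]
  · intro v w
    refine ⟨fun h => ?_, hadj K hK v w⟩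
    have := hadj (fun m => (K m)⁻¹) hK' _ _ h
    simp only [Equiv.coe_fn_mk] at this
    rwa [pK, pK, e', e'] at this

theorem conj_exists {d : ℕ} {T : SimpleGraph V} (hT : T.IsTree) (ι : LegalColoring T d)
    (F : Subgroup (Equiv.Perm (Fin d))) (L : GeodLine T) (f g : T ≃g T) (l : ℤ) (hl : 0 < l)
    (hf : f ∈ UF T F ι) (hg : g ∈ UF T F ι) (hfL : ∀ i, f (L.seq i) = L.seq (i + l))
    (hgL : ∀ i, g (L.seq i) = L.seq (i + l)) :
    ∃ u ∈ UF T F ι, (∀ i, u (L.seq i) = L.seq i) ∧ u * f = g * u := by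
  let K : ℤ → (T ≃g T) := fun i => g ^ (i / l) * f ^ (-(i / l))
  have hK : ∀ m i, K m (L.seq i) = L.seq i := by
    intro m i
    change (g ^ (m / l)) ((f ^ (-(m / l))) (L.seq i)) = L.seq i
    rw [axis_zpow L f l hfL, axis_zpow L g l hgL]
    congr 1; ring
  have hKU : ∀ m, K m ∈ UF T F ι := fun m =>
    Subgroup.mul_mem _ (Subgroup.zpow_mem _ hg _) (Subgroup.zpow_mem _ hf _)
  obtain ⟨u, hu⟩ := piecewise_aut hT L K hK
  refine ⟨u, ?_, fun i => by rw [hu, hK], ?_⟩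
  · intro v
    obtain ⟨σ, hσ, h⟩ := hKU (pr hT L v) v
    refine ⟨σ, hσ, fun w hvw => ?_⟩
    rw [h w hvw, hu, hu]
    congr 1
    rcases pr_adj hT L hvw with h | ⟨-, h⟩
    · rw [h]
    · generalize pr hT L w = j at h ⊢
      rw [h, hK, hK]
  · ext v
    change u (f v) = g (u v)
    rw [hu, hu, pr_equiv hT L f l hfL]
    have e : (pr hT L v + l) / l = pr hT L v / l + 1 := by
      have := Int.add_mul_ediv_right (pr hT L v) 1 hl.ne'
      rwa [one_mul] at this
    change (g ^ ((pr hT L v + l) / l) * f ^ (-((pr hT L v + l) / l)) * f) v =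
      (g * (g ^ (pr hT L v / l) * f ^ (-(pr hT L v / l)))) v
    rw [e]
    congr 1
    generalize pr hT L v / l = m
    group

theorem power_of_two_trans {d : ℕ} {T : SimpleGraph V} (hd : 3 ≤ d) (hT : T.IsTree)
    (ι : LegalColoring T d) (F : Subgroup (Equiv.Perm (Fin d)))
    (htrans : PermTransitive F) (hgen : GenByPointStabilizers F) (h2 : PermTwoTransitive F)
    (g : T ≃g T) (hg : g ∈ UFplus T F ι) (hyp : IsHyperbolic T g) :
    ∃ h ∈ UFplus T F ι, IsHyperbolic T h ∧ transLen T h = 2 ∧ ∃ n : ℕ, g = h ^ n := by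
  have hev : Even (transLen T g) := by
    obtain ⟨x0⟩ := hT.connected.nonempty
    obtain ⟨x, hx⟩ := Nat.sInf_mem (s := Set.range fun x : V => T.dist x (g x)) ⟨_, x0, rfl⟩
    unfold transLen
    rw [← hx]
    exact UFplus_even hT F ι g hg x
  unfold IsHyperbolic at hyp
  obtain ⟨n, hn⟩ := hev
  obtain ⟨L, hL⟩ := exists_axis hT g (by omega)
  obtain ⟨h0, h0U, h0L⟩ := extend_line hT ι F h2 L (L.shift 2)
  replace h0L : ∀ i, h0 (L.seq i) = L.seq (i + 2) := h0L
  have hfL : ∀ i, (h0 ^ n) (L.seq i) = L.seq (i + (transLen T g : ℤ)) := by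
    intro i
    rw [axis_pow L h0 2 h0L, hn]
    congr 1; push_cast; ring
  obtain ⟨u, huU, huL, hu⟩ := conj_exists hT ι F L (h0 ^ n) g (transLen T g) (by omega)
    (Subgroup.pow_mem _ h0U n) (UFplus_le T F ι hg) hfL hL
  have huL' : ∀ i, u⁻¹ (L.seq i) = L.seq i := by
    intro i
    apply u.injective
    rw [huL]
    exact u.apply_symm_apply _
  have hhL : ∀ i, (u * h0 * u⁻¹) (L.seq i) = L.seq (i + (2 : ℕ)) := by
    intro i
    change u (h0 (u⁻¹ (L.seq i))) = _
    rw [huL', h0L, huL]; rfl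
  have htl := axis_transLen hT L _ 2 (by omega) hhL
  refine ⟨u * h0 * u⁻¹, ?_, ?_, htl, n, ?_⟩
  · refine mem_UFplus hd hT F htrans ι hgen (L.seq 0) _
      (Subgroup.mul_mem _ (Subgroup.mul_mem _ huU h0U) (Subgroup.inv_mem _ huU)) ?_
    rw [hhL, L.geodesic]
    exact ⟨1, by norm_num⟩
  · unfold IsHyperbolic; omega
  · rw [conj_pow, hu, mul_inv_cancel_right]

theorem extend_ray {d : ℕ} {T : SimpleGraph V} (hd : 3 ≤ d) (hT : T.IsTree)
    (ι : LegalColoring T d) (r : GeodRay T) : ∃ L : GeodLine T, ∀ n : ℕ, L.seq n = r.seq n := by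
  have : Nontrivial (Fin d) := Fin.nontrivial_iff_two_le.mpr (by omega)
  obtain ⟨b, hb⟩ := exists_ne (ι.color (r.seq 0) (r.seq 1))
  obtain ⟨a, ha⟩ := exists_ne b
  obtain ⟨L, h0, hL⟩ := exists_line hT ι (r.seq 0)
    (fun i => if 0 ≤ i then ι.color (r.seq i.toNat) (r.seq (i.toNat + 1)) else
      if i % 2 = 0 then a else b) (by
    intro i
    rcases lt_trichotomy i (-1) with h | rfl | h
    · simp only [show ¬ 0 ≤ i by omega, show ¬ 0 ≤ i + 1 by omega, if_false]
      rcases Int.emod_two_eq_zero_or_one i with h | h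
      · simp only [h, show (i + 1) % 2 ≠ 0 by omega, if_true, if_false]; exact ha
      · simp only [h, show (i + 1) % 2 = 0 by omega, if_true]; exact ha.symm
    · simpa using hb
    · simp only [show 0 ≤ i by omega, show 0 ≤ i + 1 by omega, if_true]
      rw [show (i + 1).toNat = i.toNat + 1 by omega]
      generalize i.toNat = n
      rw [ι.symm _ _ (r.adj n)]
      intro e
      have := color_inj ι (r.adj n).symm (r.adj (n + 1)) e
      have h3 := r.geodesic n (n + 1 + 1)
      rw [← this, SimpleGraph.dist_self, Nat.dist] at h3
      omega)
  refine ⟨L, ?_⟩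
  intro n
  induction n with
  | zero => exact h0
  | succ n ih =>
    have h1 := L.adj n
    have h2 := hL n
    rw [ih] at h1 h2
    simp only [Int.natCast_nonneg, if_true, Int.toNat_natCast] at h2
    exact color_inj ι h1 (r.adj n) h2

theorem ends_of_two_trans {d : ℕ} {T : SimpleGraph V} (hd : 3 ≤ d) (hT : T.IsTree)
    (ι : LegalColoring T d) (F : Subgroup (Equiv.Perm (Fin d)))
    (htrans : PermTransitive F) (hgen : GenByPointStabilizers F) (h2 : PermTwoTransitive F)
    (ξ η : GeodRay T) : ∃ g ∈ UFplus T F ι, RayEquiv T (mapRay T g ξ) η := by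
  obtain ⟨L, hL⟩ := extend_ray hd hT ι ξ
  obtain ⟨M, hM⟩ := extend_ray hd hT ι η
  obtain ⟨s, hs⟩ : ∃ s : ℕ, Even (T.dist (ξ.seq 0) (η.seq s)) := by
    by_cases h : Even (T.dist (ξ.seq 0) (η.seq 0))
    · exact ⟨0, h⟩
    · refine ⟨1, ?_⟩
      have := hT.dist_eq_dist_add_one_of_adj (ξ.seq 0) (η.adj 0)
      rw [zero_add] at this
      rw [Nat.even_iff] at *
      omega
  obtain ⟨g, hg, hgL⟩ := extend_line hT ι F h2 L (M.shift s)
  have key : ∀ n : ℕ, g (ξ.seq n) = η.seq (s + n) := by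
    intro n
    rw [← hL, hgL, ← hM]
    change M.seq _ = _
    congr 1; push_cast; ring
  refine ⟨g, mem_UFplus hd hT F htrans ι hgen (ξ.seq 0) g hg (by rw [key]; exact hs), 0, s, ?_⟩
  intro n
  rw [zero_add]
  exact key n

theorem two_trans_of_ends {d : ℕ} {T : SimpleGraph V} (hT : T.IsTree)
    (ι : LegalColoring T d) (F : Subgroup (Equiv.Perm (Fin d)))
    (H : ∀ ξ η : GeodRay T, ∃ g ∈ UFplus T F ι, RayEquiv T (mapRay T g ξ) η) :
    PermTwoTransitive F := by
  have alt : ∀ (x : V) (a b : Fin d), a ≠ b → ∃ L : GeodLine T, L.seq 0 = x ∧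
      ∀ i, ι.color (L.seq i) (L.seq (i + 1)) = if i % 2 = 0 then a else b := by
    intro x a b hab
    refine exists_line hT ι x (fun i => if i % 2 = 0 then a else b) ?_
    intro i
    rcases Int.emod_two_eq_zero_or_one i with h | h
    · simp only [h, show (i + 1) % 2 ≠ 0 by omega, if_true, if_false]; exact hab
    · simp only [h, show (i + 1) % 2 = 0 by omega, if_true]; exact hab.symm
  intro a b c e hab hce
  obtain ⟨x⟩ := hT.connected.nonempty
  obtain ⟨L, hL0, hL⟩ := alt x a b hab
  obtain ⟨M, hM0, hM⟩ := alt x c e hce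
  obtain ⟨g, hg, k, l, hkl⟩ := H L.toRay M.toRay
  replace hkl : ∀ n : ℕ, g (L.seq ((k + n : ℕ) : ℤ)) = M.seq ((l + n : ℕ) : ℤ) := hkl
  have hpar : (k + l) % 2 = 0 := by
    have a1 := UFplus_even hT F ι g hg (L.seq k)
    have a2 := hkl 0
    rw [add_zero, add_zero] at a2
    rw [a2] at a1
    have a3 := dist_parity hT x (L.seq k) (M.seq l)
    have a4 := L.geodesic 0 k
    have a5 := M.geodesic 0 l
    rw [hL0] at a4
    rw [hM0] at a5
    rw [Nat.even_iff] at *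
    omega
  obtain ⟨σ, hσ, h⟩ := UFplus_le T F ι hg (L.seq ((k + (k + 1) : ℕ) : ℤ))
  have b0 := hkl k
  have b1 := hkl (k + 1)
  have b2 := hkl (k + 2)
  have c1 := L.adj ((k + k : ℕ) : ℤ)
  have c2 := L.adj ((k + (k + 1) : ℕ) : ℤ)
  have c3 := M.adj ((l + k : ℕ) : ℤ)
  have d1 := hL ((k + k : ℕ) : ℤ)
  have d2 := hL ((k + (k + 1) : ℕ) : ℤ)
  have d3 := hM ((l + k : ℕ) : ℤ)
  have d4 := hM ((l + (k + 1) : ℕ) : ℤ)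
  rw [if_pos (by omega)] at d1 d3
  rw [if_neg (by omega)] at d2 d4
  have e1 : (((k + k : ℕ) : ℤ) + 1) = ((k + (k + 1) : ℕ) : ℤ) := by push_cast; ring
  have e2 : (((l + k : ℕ) : ℤ) + 1) = ((l + (k + 1) : ℕ) : ℤ) := by push_cast; ring
  have e3 : (((k + (k + 1) : ℕ) : ℤ) + 1) = ((k + (k + 2) : ℕ) : ℤ) := by push_cast; ring
  have e4 : (((l + (k + 1) : ℕ) : ℤ) + 1) = ((l + (k + 2) : ℕ) : ℤ) := by push_cast; ring
  rw [e1] at d1 c1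
  rw [e2] at d3 c3
  rw [e3] at d2 c2
  rw [e4] at d4
  have f1 := h _ c1.symm
  have f2 := h _ c2
  rw [b0, b1, ι.symm _ _ c1.symm, ι.symm _ _ c3.symm, d1, d3] at f1
  rw [b1, b2, d2, d4] at f2
  exact ⟨σ, hσ, f1, f2⟩

theorem two_trans_of_power {d : ℕ} {T : SimpleGraph V} (hd : 3 ≤ d) (hT : T.IsTree)
    (ι : LegalColoring T d) (F : Subgroup (Equiv.Perm (Fin d)))
    (htrans : PermTransitive F) (hgen : GenByPointStabilizers F)
    (H : ∀ g ∈ UFplus T F ι, IsHyperbolic T g →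
        ∃ h ∈ UFplus T F ι, IsHyperbolic T h ∧ transLen T h = 2 ∧ ∃ n : ℕ, g = h ^ n) :
    PermTwoTransitive F := by
  have : Nontrivial (Fin d) := Fin.nontrivial_iff_two_le.mpr (by omega)
  have third : ∀ a b : Fin d, ∃ c, c ≠ a ∧ c ≠ b := by
    intro a b
    have : ∃ c, c ∉ ({a, b} : Finset (Fin d)) := by
      by_contra hcon
      push Not at hcon
      have h1 : Finset.univ ⊆ ({a, b} : Finset (Fin d)) := fun c _ => hcon c
      have h2 := Finset.card_le_card h1
      have h3 := Finset.card_le_two (a := a) (b := b)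
      rw [Finset.card_univ, Fintype.card_fin] at h2
      omega
    obtain ⟨c, hc⟩ := this
    simp only [Finset.mem_insert, Finset.mem_singleton, not_or] at hc
    exact ⟨c, hc⟩
  have key : ∀ a b p q : Fin d, a ≠ b → b ≠ p → p ≠ q → ∃ σ ∈ F, σ a = p ∧ σ b = q := by
    intro a b p q hab hbp hpq
    obtain ⟨r, hr⟩ := exists_ne q
    obtain ⟨s, hsr, hsa⟩ := third r a
    obtain ⟨x⟩ := hT.connected.nonempty
    let c : ℤ → Fin d := fun i => if i % 6 = 0 then a else if i % 6 = 1 then b else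
      if i % 6 = 2 then p else if i % 6 = 3 then q else if i % 6 = 4 then r else s
    have hc : ∀ i, c i ≠ c (i + 1) := by
      intro i
      have h6 : i % 6 = 0 ∨ i % 6 = 1 ∨ i % 6 = 2 ∨ i % 6 = 3 ∨ i % 6 = 4 ∨ i % 6 = 5 := by omega
      rcases h6 with h | h | h | h | h | h
      · have h' : (i + 1) % 6 = 1 := by omega
        simp only [c, h, h']; norm_num; exact hab
      · have h' : (i + 1) % 6 = 2 := by omega
        simp only [c, h, h']; norm_num; exact hbp
      · have h' : (i + 1) % 6 = 3 := by omega
        simp only [c, h, h']; norm_num; exact hpq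
      · have h' : (i + 1) % 6 = 4 := by omega
        simp only [c, h, h']; norm_num; exact hr.symm
      · have h' : (i + 1) % 6 = 5 := by omega
        simp only [c, h, h']; norm_num; exact hsr.symm
      · have h' : (i + 1) % 6 = 0 := by omega
        simp only [c, h, h']; norm_num; exact hsa
    obtain ⟨L, hL0, hL⟩ := exists_line hT ι x c hc
    obtain ⟨g, hg0, hgc⟩ := exists_aut hT ι (fun _ => 1) (fun _ _ _ => rfl) (L.seq 0) (L.seq (0 + 6))
    have hgL : ∀ i, g (L.seq i) = L.seq (i + (6 : ℕ)) := by
      refine line_track ι L (L.shift 6) g hg0 ?_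
      intro i
      change _ = ι.color (L.seq (i + 6)) (L.seq (i + 1 + 6))
      rw [← hgc _ _ (L.adj i), show i + 1 + 6 = i + 6 + 1 by ring, hL, hL]
      simp [c]
    have hgU : g ∈ UF T F ι := fun v => ⟨1, F.one_mem, fun w h => hgc v w h⟩
    have hgP : g ∈ UFplus T F ι := by
      refine mem_UFplus hd hT F htrans ι hgen (L.seq 0) g hgU ?_
      rw [hgL, L.geodesic]
      exact ⟨3, by norm_num⟩
    have htl := axis_transLen hT L g 6 (by omega) hgL
    obtain ⟨h, hh, -, h2, n, hn⟩ := H g hgP (by unfold IsHyperbolic; omega)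
    obtain ⟨M, hM⟩ := exists_axis hT h (by omega)
    rw [h2] at hM
    have hgM : ∀ i, g (M.seq i) = M.seq (i + ((2 * n : ℕ) : ℤ)) := by
      intro i
      rw [hn, axis_pow M h _ hM]
      congr 1; push_cast; ring
    have hn0 : 0 < n := by
      rcases Nat.eq_zero_or_pos n with h' | h'
      · exfalso
        subst h'
        have e1 := hgL 0
        rw [hn, pow_zero] at e1
        have := L.inj (show L.seq 0 = _ from e1)
        omega
      · exact h'
    have htl' := axis_transLen hT M g (2 * n) (by omega) hgM
    obtain rfl : n = 3 := by omega
    have hLM : ∀ i, L.seq i = M.seq (pr hT M (L.seq i)) := by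
      intro i
      have h1 := axis_dist hT M g _ (by omega) hgM (L.seq i)
      rw [hgL, L.geodesic] at h1
      exact hT.connected.dist_eq_zero_iff.mp (by omega)
    set Q : ℤ → ℤ := fun i => pr hT M (L.seq i) with hQ
    replace hLM : ∀ i, L.seq i = M.seq (Q i) := hLM
    have hQd : ∀ i j, (Q i - Q j).natAbs = (i - j).natAbs := by
      intro i j
      rw [← L.geodesic i j, ← M.geodesic, ← hLM, ← hLM]
    have hQ6 : Q 6 = Q 0 + 6 := by
      have h1 := pr_equiv hT M g _ hgM (L.seq 0)
      rw [hgL] at h1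
      exact h1
    have hQi : ∀ i, 0 ≤ i → i ≤ 6 → Q i = Q 0 + i := by
      intro i hi hi'
      have h1 := hQd i 0
      have h2 := hQd i 6
      omega
    have hhL : ∀ i, 0 ≤ i → i ≤ 4 → h (L.seq i) = L.seq (i + 2) := by
      intro i hi hi'
      rw [hLM i, hM, hLM (i + 2), hQi i hi (by omega), hQi (i + 2) (by omega) (by omega)]
      congr 1; push_cast; ring
    obtain ⟨σ, hσ, hs⟩ := UFplus_le T F ι hh (L.seq 1)
    have a1 := L.adj 0
    have a2 := L.adj 1
    have a3 := L.adj 2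
    have b0 := hL 0
    have b1 := hL 1
    have b2 := hL 2
    have b3 := hL 3
    norm_num [c] at a1 a2 a3 b0 b1 b2 b3
    have f1 := hs _ a1.symm
    have f2 := hs _ a2
    have g0 := hhL 0 (by norm_num) (by norm_num)
    have g1 := hhL 1 (by norm_num) (by norm_num)
    have g2 := hhL 2 (by norm_num) (by norm_num)
    norm_num at g0 g1 g2
    rw [g0, g1, ι.symm _ _ a1.symm, ι.symm _ _ a3.symm, b0, b2] at f1
    rw [g1, g2, b1, b3] at f2
    exact ⟨σ, hσ, f1, f2⟩
  intro a b c e hab hce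
  obtain ⟨c', hc'⟩ := exists_ne b
  obtain ⟨τ, hτ, hτc⟩ := htrans c c'
  obtain ⟨σ, hσ, h1, h2⟩ := key a b c' (τ e) hab hc'.symm (by
    rw [← hτc]; exact fun h => hce (τ.injective h))
  refine ⟨τ⁻¹ * σ, F.mul_mem (F.inv_mem hτ) hσ, ?_, ?_⟩
  · rw [Equiv.Perm.mul_apply, h1, ← hτc]; exact τ.symm_apply_apply c
  · rw [Equiv.Perm.mul_apply, h2]; exact τ.symm_apply_apply e

/-- Let `F` be transitive and generated by its point stabilizers, and
`𝔾 = U(F)⁺`.  Then `𝔾` is transitive on `∂𝒯` iff every hyperbolic element of `𝔾` is a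
power of a hyperbolic element of `𝔾` of translation length two. -/
theorem end_transitive_iff_hyperbolic_powers
    {V : Type} (T : SimpleGraph V) (d : ℕ) (hd : 3 ≤ d)
    (hT : T.IsTree) (hreg : Regular T d) (ι : LegalColoring T d)
    (F : Subgroup (Equiv.Perm (Fin d)))
    (htrans : PermTransitive F) (hgen : GenByPointStabilizers F) :
    (∀ ξ η : GeodRay T, ∃ g ∈ UFplus T F ι, RayEquiv T (mapRay T g ξ) η) ↔
      ∀ g ∈ UFplus T F ι, IsHyperbolic T g →
        ∃ h ∈ UFplus T F ι, IsHyperbolic T h ∧ transLen T h = 2 ∧ ∃ n : ℕ, g = h ^ n := by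
  constructor
  · intro H g hg hyp
    exact power_of_two_trans hd hT ι F htrans hgen (two_trans_of_ends hT ι F H) g hg hyp
  · intro H ξ η
    exact ends_of_two_trans hd hT ι F htrans hgen
      (two_trans_of_power hd hT ι F htrans hgen H) ξ η

end TreeHM
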